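/- The complex vector space of modular forms of weight 4 for the Hecke congruence subgroup Γ₀(2) has dimension 2. -/

import Mathlib

open UpperHalfPlane ModularForm SlashInvariantForm SlashInvariantFormClass ModularFormClass
  MatrixGroups OnePoint Filter EisensteinSeries Asymptotics CongruenceSubgroup
open scoped Topology Pointwise

section order

variable {Γ : Subgroup (GL (Fin 2) ℝ)} {k : ℤ} {f : ModularForm Γ k}

/-- A modular form whose first `n` Fourier coefficients vanish is `O(q ^ n)` at infinity. -/
lemma ModularForm.isBigO_qParam_pow {h : ℝ} (hh : 0 < h) (hΓ : h ∈ Γ.strictPeriods) {n : ℕ}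
    (hf : ∀ i < n, (qExpansion h f).coeff i = 0) :
    f =O[atImInfty] fun τ : ℍ ↦ Function.Periodic.qParam h τ ^ n := by
  have : Fact (IsCusp ∞ Γ) := ⟨Γ.isCusp_of_mem_strictPeriods hh hΓ⟩
  have hp := (hasFPowerSeries_cuspFunction f hh
    (ModularFormClass.analyticAt_cuspFunction_zero f hh hΓ)
    (ModularForm.hasSum_qExpansion f hh hΓ)).hasFPowerSeriesAt.isBigO_sub_partialSum_pow n
  have hsum (y : ℂ) : (qExpansionFormalMultilinearSeries h f).partialSum n y = 0 :=
    Finset.sum_eq_zero fun i hi ↦ by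
      simp [hf i (Finset.mem_range.mp hi)]
  refine ((hp.comp_tendsto (qParam_tendsto_atImInfty hh)).congr (fun τ ↦ ?_) fun τ ↦ rfl).trans
    (isBigO_of_le _ fun τ ↦ by simp)
  simp [hsum, SlashInvariantFormClass.eq_cuspFunction f τ hΓ hh.ne']

/-- A modular form which is `O(q ^ 2)` at infinity has a `q`-expansion of order at least `2`. -/
lemma ModularForm.two_le_order_qExpansion {h : ℝ} (hh : 0 < h)
    (hf : f =O[atImInfty] fun τ : ℍ ↦ Function.Periodic.qParam h τ ^ 2) :
    2 ≤ (qExpansion h f).order := by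
  have hzero : IsZeroAtImInfty f := hf.trans_tendsto <| by
    simpa using (qParam_tendsto_atImInfty hh).pow 2
  have h0 : cuspFunction h f 0 = 0 := hzero.cuspFunction_apply_zero hh
  have hO : cuspFunction h f =O[𝓝[≠] 0] fun q ↦ ‖q - 0‖ ^ 2 := by
    have hlim := tendsto_comap_im_ofComplex.comp (Function.Periodic.invQParam_tendsto hh)
    refine ((hf.comp_tendsto hlim).congr' ?_ ?_).trans
      (isBigO_of_le (f := fun q : ℂ ↦ q ^ 2) _ fun q ↦ by simp)
    · filter_upwards [self_mem_nhdsWithin] with q hq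
      exact (Function.Periodic.cuspFunction_eq_of_nonzero h (f ∘ ofComplex) hq).symm
    · filter_upwards [self_mem_nhdsWithin,
        Function.Periodic.invQParam_tendsto hh (preimage_mem_comap (Ioi_mem_atTop 0))] with q hq him
      simp [ofComplex_apply_of_im_pos him, Function.Periodic.qParam_right_inv hh.ne' hq]
  have hO' : cuspFunction h f =O[𝓝 0] fun q ↦ ‖q - 0‖ ^ 2 := by
    rw [← nhdsNE_sup_pure, isBigO_sup]
    exact ⟨hO, isBigO_pure.mpr fun _ ↦ h0⟩
  have h1 : deriv (cuspFunction h f) 0 = 0 := by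
    simpa using (hO'.hasFDerivAt (𝕜 := ℂ) one_lt_two).hasDerivAt.deriv
  refine PowerSeries.nat_le_order _ 2 fun i hi ↦ ?_
  interval_cases i <;> simp [qExpansion_coeff, h0, h1]

end order

/-- The cosets of `Γ₀(2)` in `SL(2, ℤ)` are separated by the first column modulo `2`. -/
lemma card_quotient_Gamma0_two_le :
    Nat.card (𝒮ℒ ⧸ (Gamma0 2 : Subgroup (GL (Fin 2) ℝ)).subgroupOf 𝒮ℒ) ≤ 4 := by
  let lift (q : 𝒮ℒ ⧸ (Gamma0 2 : Subgroup (GL (Fin 2) ℝ)).subgroupOf 𝒮ℒ) : SL(2, ℤ) :=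
    q.out.2.choose
  have hlift (q) : Matrix.SpecialLinearGroup.mapGL ℝ (lift q) = (q.out : GL (Fin 2) ℝ) :=
    q.out.2.choose_spec
  let col (q : 𝒮ℒ ⧸ (Gamma0 2 : Subgroup (GL (Fin 2) ℝ)).subgroupOf 𝒮ℒ) : ZMod 2 × ZMod 2 :=
    (lift q 0 0, lift q 1 0)
  refine (Nat.card_le_card_of_injective col fun q r hqr ↦ ?_).trans (by simp)
  obtain ⟨h0, h1⟩ := Prod.ext_iff.mp hqr
  rw [← q.out_eq', ← r.out_eq', QuotientGroup.eq, Subgroup.mem_subgroupOf]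
  refine ⟨(lift q)⁻¹ * lift r, ?_, by simp [hlift]⟩
  simp only [col] at h0 h1
  have hentry : ((lift q)⁻¹ * lift r) 1 0 =
      -lift q 1 0 * lift r 0 0 + lift q 0 0 * lift r 1 0 := by
    simp [Matrix.SpecialLinearGroup.coe_mul, Matrix.adjugate_fin_two, Matrix.mul_apply,
      Fin.sum_univ_two]
  rw [SetLike.mem_coe, Gamma0_mem, hentry]
  push_cast
  rw [h0, h1]
  ring

/-- A Sturm bound: a form of weight four for `Γ₀(2)` is determined by its first two Fourier
coefficients. -/
lemma ModularForm.eq_zero_of_Gamma0_two_weight_four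
    (f : ModularForm (Gamma0 2) 4) (h0 : (qExpansion 1 f).coeff 0 = 0)
    (h1 : (qExpansion 1 f).coeff 1 = 0) : f = 0 := by
  classical
  have hfO := f.isBigO_qParam_pow (h := 1) (n := 2) one_pos (by simp)
    (fun i hi ↦ by interval_cases i <;> assumption)
  suffices ModularForm.norm 𝒮ℒ f = 0 by simpa [ModularForm.norm_eq_zero_iff] using this
  apply sturm_bound_levelOne
  refine lt_of_lt_of_le ?_ (ModularForm.two_le_order_qExpansion one_pos ?_)
  · have := card_quotient_Gamma0_two_le
    norm_cast
    omega
  · let := Fintype.ofFinite (𝒮ℒ ⧸ (Gamma0 2 : Subgroup (GL (Fin 2) ℝ)).subgroupOf 𝒮ℒ)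
    let q₀ : 𝒮ℒ ⧸ (Gamma0 2 : Subgroup (GL (Fin 2) ℝ)).subgroupOf 𝒮ℒ := ⟦1⟧
    have hprod := Finset.mul_prod_erase Finset.univ (quotientFunc (ℋ := 𝒮ℒ) f) (Finset.mem_univ q₀)
    rw [ModularForm.coe_norm, ← hprod]
    have hO : (∏ q ∈ Finset.univ.erase q₀, quotientFunc (ℋ := 𝒮ℒ) f q) =O[atImInfty]
        fun _ ↦ (1 : ℝ) := by
      rw [show (fun _ : ℍ ↦ (1 : ℝ)) = fun x ↦ ∏ q ∈ Finset.univ.erase q₀, 1 by simp, Finset.prod_fn]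
      refine .finsetProd fun q _ ↦ ?_
      induction q using Quotient.inductionOn with | h r =>
      obtain ⟨γ, hγ⟩ := r.2
      have := ModularFormClass.bdd_at_infty_slash f γ⁻¹
      rw [SL_slash] at this
      rw [quotientFunc_mk, ← hγ, ← map_inv]
      exact this
    have hf₁ : quotientFunc (ℋ := 𝒮ℒ) f q₀ = f := by
      rw [quotientFunc_mk, OneMemClass.coe_one, inv_one, SlashAction.slash_one]
    rw [hf₁]
    exact (hfO.mul (hO.trans (isBigO_of_le (g := fun _ ↦ (1 : ℂ)) _ fun _ ↦ by simp))).trans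
      (isBigO_of_le _ fun _ ↦ by simp)

/-- The space of forms of weight four for `Γ₀(2)` has dimension at most two. -/
lemma ModularForm.rank_Gamma0_two_weight_four_le :
    Module.rank ℂ (ModularForm (Gamma0 2) 4) ≤ 2 := by
  have hΓ : 1 ∈ (Gamma0 2 : Subgroup (GL (Fin 2) ℝ)).strictPeriods := by simp
  let φ : ModularForm (Gamma0 2) 4 →ₗ[ℂ] ℂ × ℂ :=
    { toFun f := ((qExpansion 1 f).coeff 0, (qExpansion 1 f).coeff 1)
      map_add' f g := by
        simp [-PowerSeries.coeff_zero_eq_constantCoeff, ModularForm.qExpansion_add one_pos hΓ]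
      map_smul' c f := by
        simp [-PowerSeries.coeff_zero_eq_constantCoeff, ModularForm.qExpansion_smul one_pos hΓ] }
  have hφ : Function.Injective φ := (injective_iff_map_eq_zero φ).mpr fun f hf ↦
    eq_zero_of_Gamma0_two_weight_four f (congrArg Prod.fst hf) (congrArg Prod.snd hf)
  simpa [one_add_one_eq_two] using φ.rank_le_of_injective hφ

/-- Restriction of a modular form to a subgroup. -/
def ModularForm.restrict {Γ Γ' : Subgroup (GL (Fin 2) ℝ)} {k : ℤ} (h : Γ' ≤ Γ)
    (f : ModularForm Γ k) : ModularForm Γ' k where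
  toFun := f
  slash_action_eq' γ hγ := f.slash_action_eq' γ (h hγ)
  holo' := f.holo'
  bdd_at_cusps' hc := f.bdd_at_cusps' (hc.mono h)

/-- The diagonal matrix `diag(2, 1)`. -/
noncomputable def diagTwoOne : GL (Fin 2) ℝ :=
  Matrix.GeneralLinearGroup.mkOfDetNeZero !![2, 0; 0, 1] (by simp)

/-- The diagonal matrix `diag(1, 2)`. -/
noncomputable def diagOneTwo : GL (Fin 2) ℝ :=
  Matrix.GeneralLinearGroup.mkOfDetNeZero !![1, 0; 0, 2] (by simp)

/-- `Γ₀(2)` is contained in the stabiliser of translates of level one forms by `diag(2, 1)`. -/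
lemma Gamma0_two_le_conj_diagTwoOne :
    (Gamma0 2 : Subgroup (GL (Fin 2) ℝ)) ≤ ConjAct.toConjAct diagTwoOne⁻¹ • 𝒮ℒ := by
  rintro _ ⟨γ, hγ, rfl⟩
  obtain ⟨c, hc⟩ := (ZMod.intCast_zmod_eq_zero_iff_dvd _ 2).mp (Gamma0_mem.mp hγ)
  rw [Subgroup.mem_pointwise_smul_iff_inv_smul_mem, ← ConjAct.toConjAct_inv, inv_inv,
    ConjAct.toConjAct_smul]
  have hdet : !![γ 0 0, 2 * γ 0 1; c, γ 1 1].det = 1 := by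
    have := Matrix.SpecialLinearGroup.det_coe γ
    rw [Matrix.det_fin_two, hc] at this
    rw [Matrix.det_fin_two_of]
    push_cast at this
    linear_combination this
  obtain ⟨δ, hδ⟩ : ∃ δ : SL(2, ℤ), δ.1 = !![γ 0 0, 2 * γ 0 1; c, γ 1 1] := ⟨⟨_, hdet⟩, rfl⟩
  refine ⟨δ, ?_⟩
  rw [eq_mul_inv_iff_mul_eq]
  ext i j
  fin_cases i <;> fin_cases j <;>
    simp [diagTwoOne, Matrix.mul_apply, hδ, hc, mul_comm]

lemma diagTwoOne_mul_S :
    diagTwoOne * (ModularGroup.S : GL (Fin 2) ℝ) =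
      (ModularGroup.S : GL (Fin 2) ℝ) * diagOneTwo := by
  change diagTwoOne * Matrix.SpecialLinearGroup.mapGL ℝ ModularGroup.S =
    Matrix.SpecialLinearGroup.mapGL ℝ ModularGroup.S * diagOneTwo
  ext i j
  fin_cases i <;> fin_cases j <;>
    simp [diagTwoOne, diagOneTwo, Matrix.mul_apply]

/-- The Eisenstein series `E₄` tends to `1` at infinity. -/
lemma tendsto_E₄ : Tendsto E₄ atImInfty (𝓝 1) := by
  have han := ModularFormClass.analyticAt_cuspFunction_zero E₄ one_pos one_mem_strictPeriods_SL
  have h0 : cuspFunction 1 E₄ 0 = 1 := by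
    simpa [qExpansion_coeff] using E_qExpansion_coeff_zero (k := 4) (by norm_num) ⟨2, rfl⟩
  rw [← h0]
  exact (han.continuousAt.tendsto.comp (qParam_tendsto_atImInfty one_pos)).congr
    fun τ ↦ SlashInvariantFormClass.eq_cuspFunction E₄ τ one_mem_strictPeriods_SL one_ne_zero

/-- Slashing by an upper triangular matrix of positive determinant rescales limits at infinity. -/
lemma UpperHalfPlane.tendsto_slash_atImInfty {g : GL (Fin 2) ℝ} (hg : g 1 0 = 0)
    (hdet : 0 < g.det.val)
    {f : ℍ → ℂ} {L : ℂ} (hf : Tendsto f atImInfty (𝓝 L)) (k : ℤ) :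
    Tendsto (f ∣[k] g) atImInfty (𝓝 (L * (g.det.val : ℂ) ^ (k - 1) * (g 1 1 : ℂ) ^ (-k))) := by
  have := (hf.comp (tendsto_smul_atImInfty hg)).mul_const
    ((g.det.val : ℂ) ^ (k - 1) * (g 1 1 : ℂ) ^ (-k))
  simpa [ModularForm.slash_def, denom, hg, mul_assoc, σ, hdet, abs_of_pos,
    -Matrix.GeneralLinearGroup.val_det_apply] using! this

/-- The form `E₄` and its translate by `diag(2, 1)` are linearly independent. -/
lemma ModularForm.two_le_rank_Gamma0_two_weight_four :
    2 ≤ Module.rank ℂ (ModularForm (Gamma0 2) 4) := by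
  let e₁ : ModularForm (Gamma0 2) 4 := E₄.restrict (Subgroup.map_le_range _ _)
  let e₂ : ModularForm (Gamma0 2) 4 :=
    (translate E₄ diagTwoOne).restrict Gamma0_two_le_conj_diagTwoOne
  have hli : LinearIndependent ℂ ![e₁, e₂] := by
    refine LinearIndependent.pair_iff.mpr fun a b hab ↦ ?_
    have hfun : a • (⇑E₄ : ℍ → ℂ) + b • (⇑E₄ ∣[(4 : ℤ)] diagTwoOne) = 0 := congrArg (⇑) hab
    have hS : a • (⇑E₄ : ℍ → ℂ) + b • (⇑E₄ ∣[(4 : ℤ)] diagOneTwo) = 0 := by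
      have hE : ⇑E₄ ∣[(4 : ℤ)] (ModularGroup.S : GL (Fin 2) ℝ) = ⇑E₄ :=
        E₄.slash_action_eq' _ ⟨ModularGroup.S, rfl⟩
      have := congrArg (· ∣[(4 : ℤ)] ModularGroup.S) hfun
      simp only [SlashAction.add_slash, SL_smul_slash, SlashAction.zero_slash] at this
      rwa [SL_slash, SL_slash, ← SlashAction.slash_mul, diagTwoOne_mul_S, SlashAction.slash_mul,
        hE] at this
    have h1 := ((tendsto_E₄.const_mul a).add ((UpperHalfPlane.tendsto_slash_atImInfty
      (g := diagTwoOne) (by simp [diagTwoOne]) (by simp [diagTwoOne]) tendsto_E₄ 4).const_mul b)).congr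
      (congrFun hfun)
    have h2 := ((tendsto_E₄.const_mul a).add ((UpperHalfPlane.tendsto_slash_atImInfty
      (g := diagOneTwo) (by simp [diagOneTwo]) (by simp [diagOneTwo]) tendsto_E₄ 4).const_mul b)).congr
      (congrFun hS)
    have hab₁ : a + b * 8 = 0 := by
      convert tendsto_nhds_unique h1 (tendsto_const_nhds (x := 0)) using 1
      norm_num [diagTwoOne]
    have hab₂ : a + b / 2 = 0 := by
      convert tendsto_nhds_unique h2 (tendsto_const_nhds (x := 0)) using 1
      norm_num [diagOneTwo, div_eq_mul_inv]
    constructor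
    · linear_combination -1 / 15 * hab₁ + 16 / 15 * hab₂
    · linear_combination 2 / 15 * hab₁ - 2 / 15 * hab₂
  simpa using hli.cardinal_le_rank

/-- The complex vector space of modular forms of weight 4 for the Hecke congruence
subgroup `Γ₀(2)` has dimension 2. -/
theorem rank_modularForm_Gamma0_two_weight_four :
    Module.rank ℂ (ModularForm (CongruenceSubgroup.Gamma0 2) 4) = 2 :=
  le_antisymm ModularForm.rank_Gamma0_two_weight_four_le
    ModularForm.two_le_rank_Gamma0_two_weight_four
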